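/- arXiv:1903.03541 — 2 statements merged into one kernel-verified Lean document; each statement's English description precedes it below -/
import Mathlib

section
/- Let C ∈ K₀ be a primitive extension of B ⊆ C with |C ∖ B| ≥ 2. Then every nontrivial line ℓ of C with ℓ ∩ (C ∖ B) ≠ ∅ satisfies |ℓ ∩ B| ≤ 1. Furthermore, if C is 0-primitive over B (i.e., δ(C) = δ(B)), then every point of C ∖ B lies on at least two distinct lines of C based in C ∖ B. -/
open scoped Classical

/-- A (one-sorted) linear space: a ternary collinearity relation that holds only of
pairwise distinct triples, is invariant under all permutations of its arguments, and
satisfies that two points determine at most one line. -/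
structure IsLinearSpace {M : Type*} (R : M → M → M → Prop) : Prop where
  ne12 : ∀ {a b c : M}, R a b c → a ≠ b
  ne23 : ∀ {a b c : M}, R a b c → b ≠ c
  ne13 : ∀ {a b c : M}, R a b c → a ≠ c
  swap12 : ∀ {a b c : M}, R a b c → R b a c
  swap23 : ∀ {a b c : M}, R a b c → R a c b
  line : ∀ {x y z w : M}, R x y z → R x y w → z ≠ w → R x w z

/-- `X` is an `R`-clique: every three pairwise distinct elements of `X` satisfy `R`. -/
def FinClique {M : Type*} (R : M → M → M → Prop) (X : Finset M) : Prop :=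
  ∀ a ∈ X, ∀ b ∈ X, ∀ c ∈ X, a ≠ b → b ≠ c → a ≠ c → R a b c

/-- `ℓ` is a nontrivial line of the induced structure on `A`:
a maximal `R`-clique of `A` of size at least 3. -/
def IsLineOf {M : Type*} (R : M → M → M → Prop) (A ℓ : Finset M) : Prop :=
  ℓ ⊆ A ∧ 3 ≤ ℓ.card ∧ FinClique R ℓ ∧
    ∀ ℓ' : Finset M, ℓ' ⊆ A → FinClique R ℓ' → ℓ ⊆ ℓ' → ℓ' = ℓ

/-- The (finite) set of nontrivial lines of the induced structure on `A`. -/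
noncomputable def linesOf {M : Type*} (R : M → M → M → Prop) (A : Finset M) :
    Finset (Finset M) :=
  A.powerset.filter fun ℓ => IsLineOf R A ℓ

/-- The predimension `δ(A) = |A| - Σ_{ℓ ∈ L(A)} (|ℓ| - 2)`. -/
noncomputable def delta {M : Type*} (R : M → M → M → Prop) (A : Finset M) : ℤ :=
  (A.card : ℤ) - ∑ ℓ ∈ linesOf R A, ((ℓ.card : ℤ) - 2)

/-- Membership in the class `K₀`: all subsets have nonnegative predimension. -/
def InK0 {M : Type*} (R : M → M → M → Prop) (A : Finset M) : Prop :=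
  ∀ A' ⊆ A, 0 ≤ delta R A'

/-- `A ≤ B`: `A` is a strong substructure of `B`. -/
def Strong {M : Type*} (R : M → M → M → Prop) (A B : Finset M) : Prop :=
  A ⊆ B ∧ ∀ X : Finset M, A ⊆ X → X ⊆ B → delta R A ≤ delta R X

/-- `C` is a primitive extension of `B`. -/
def PrimitiveExt {M : Type*} (R : M → M → M → Prop) (B C : Finset M) : Prop :=
  Strong R B C ∧ ¬ ∃ A₀ : Finset M, B ⊂ A₀ ∧ A₀ ⊂ C ∧ Strong R B A₀ ∧ Strong R A₀ C

section LinearSpace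

variable {M : Type*} {R : M → M → M → Prop}

theorem IsLinearSpace.rel_of_common_pair (hLS : IsLinearSpace R) {x y a b c : M}
    (ha : a = x ∨ a = y ∨ R x y a) (hb : b = x ∨ b = y ∨ R x y b) (hc : c = x ∨ c = y ∨ R x y c)
    (hab : a ≠ b) (hbc : b ≠ c) (hac : a ≠ c) : R a b c := by
  have swap12 := @hLS.swap12
  have swap23 := @hLS.swap23
  have line := @hLS.line
  rcases ha with rfl | rfl | ha <;> rcases hb with rfl | rfl | hb <;>
    rcases hc with rfl | rfl | hc <;> first
      | exact absurd rfl ‹_›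
      | exact ‹_›
      | exact swap12 ‹_›
      | exact swap23 ‹_›
      | exact swap12 (swap23 ‹_›)
      | exact swap23 (swap12 ‹_›)
      | exact swap23 (swap12 (swap23 ‹_›))
      | skip
  · exact line hc hb hbc.symm
  · exact line (swap12 hc) (swap12 hb) hbc.symm
  · exact swap12 (line hc ha hac.symm)
  · exact swap12 (line (swap12 hc) (swap12 ha) hac.symm)
  · exact swap23 (swap12 (line hb ha hab.symm))
  · exact swap23 (swap12 (line (swap12 hb) (swap12 ha) hab.symm))
  · exact swap23 (line (swap12 (line hb ha hab.symm)) (swap12 (line hc ha hac.symm)) hbc)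

theorem FinClique.mono {X Y : Finset M} (hY : FinClique R Y) (h : X ⊆ Y) : FinClique R X :=
  fun a ha b hb c hc => hY a (h ha) b (h hb) c (h hc)

theorem FinClique.union (hLS : IsLinearSpace R) {X Y : Finset M} (hX : FinClique R X)
    (hY : FinClique R Y) (h : 2 ≤ (X ∩ Y).card) : FinClique R (X ∪ Y) := by
  obtain ⟨x, hx, y, hy, hxy⟩ := Finset.one_lt_card.1 h
  rw [Finset.mem_inter] at hx hy
  have key : ∀ p ∈ X ∪ Y, p = x ∨ p = y ∨ R x y p := by
    intro p hp
    by_cases hpx : p = x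
    · exact Or.inl hpx
    by_cases hpy : p = y
    · exact Or.inr (Or.inl hpy)
    rcases Finset.mem_union.1 hp with hp | hp
    · exact Or.inr (Or.inr (hX x hx.1 y hy.1 p hp hxy (Ne.symm hpy) (Ne.symm hpx)))
    · exact Or.inr (Or.inr (hY x hx.2 y hy.2 p hp hxy (Ne.symm hpy) (Ne.symm hpx)))
  exact fun a ha b hb c hc => hLS.rel_of_common_pair (key a ha) (key b hb) (key c hc)

theorem mem_linesOf {A ℓ : Finset M} : ℓ ∈ linesOf R A ↔ IsLineOf R A ℓ := by
  simp only [linesOf, Finset.mem_filter, Finset.mem_powerset, and_iff_right_iff_imp]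
  exact fun h => h.1

theorem IsLineOf.subset_of_finClique (hLS : IsLinearSpace R) {A ℓ X : Finset M}
    (hℓ : IsLineOf R A ℓ) (hXA : X ⊆ A) (hX : FinClique R X) (h : 2 ≤ (ℓ ∩ X).card) : X ⊆ ℓ := by
  have := hℓ.2.2.2 (ℓ ∪ X) (Finset.union_subset hℓ.1 hXA) (hℓ.2.2.1.union hLS hX h)
    Finset.subset_union_left
  exact Finset.union_eq_left.1 this

theorem IsLineOf.inter (hLS : IsLinearSpace R) {A C ℓ : Finset M} (hAC : A ⊆ C)
    (hℓ : IsLineOf R C ℓ) (h : 3 ≤ (ℓ ∩ A).card) : IsLineOf R A (ℓ ∩ A) := by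
  refine ⟨Finset.inter_subset_right, h, hℓ.2.2.1.mono Finset.inter_subset_left, ?_⟩
  intro X hXA hX hsub
  refine Finset.Subset.antisymm (Finset.subset_inter ?_ hXA) hsub
  refine hℓ.subset_of_finClique hLS (hXA.trans hAC) hX ?_
  have := Finset.card_le_card (Finset.subset_inter Finset.inter_subset_left hsub)
  omega

theorem FinClique.exists_isLineOf {C X : Finset M} (hXC : X ⊆ C) (hX : FinClique R X)
    (h : 3 ≤ X.card) : ∃ ℓ, IsLineOf R C ℓ ∧ X ⊆ ℓ := by
  obtain ⟨ℓ, hXℓ, hmax⟩ := (C.powerset.filter (FinClique R)).exists_le_maximal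
    (Finset.mem_filter.2 ⟨Finset.mem_powerset.2 hXC, hX⟩)
  have hmem := Finset.mem_filter.1 hmax.1
  refine ⟨ℓ, ⟨Finset.mem_powerset.1 hmem.1, h.trans (Finset.card_le_card hXℓ), hmem.2, ?_⟩, hXℓ⟩
  intro ℓ' hC hcl hsub
  exact Finset.Subset.antisymm
    (hmax.2 (Finset.mem_filter.2 ⟨Finset.mem_powerset.2 hC, hcl⟩) hsub) hsub

/-- The predimension of a substructure, computed from the lines of the ambient space. -/
theorem delta_eq_of_subset (hLS : IsLinearSpace R) {A C : Finset M} (hAC : A ⊆ C) :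
    delta R A = (A.card : ℤ) - ((∑ ℓ ∈ linesOf R C, ((ℓ ∩ A).card - 2) : ℕ) : ℤ) := by
  rw [delta, Nat.cast_sum]
  congr 1
  symm
  rw [← Finset.sum_filter_of_ne (p := fun ℓ => 3 ≤ (ℓ ∩ A).card)
    (by intro ℓ _ h; norm_cast at h; omega)]
  refine Finset.sum_bij (fun ℓ _ => ℓ ∩ A) ?_ ?_ ?_ ?_
  · intro ℓ hℓ
    rw [Finset.mem_filter, mem_linesOf] at hℓ
    exact mem_linesOf.2 (hℓ.1.inter hLS hAC hℓ.2)
  · intro ℓ hℓ m hm heq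
    rw [Finset.mem_filter, mem_linesOf] at hℓ hm
    have hsub : ℓ ∩ A ⊆ ℓ ∩ m :=
      Finset.subset_inter Finset.inter_subset_left (heq ▸ Finset.inter_subset_left)
    have hc := Finset.card_le_card hsub
    exact Finset.Subset.antisymm
      (hm.1.subset_of_finClique hLS hℓ.1.1 hℓ.1.2.2.1 (by rw [Finset.inter_comm]; omega))
      (hℓ.1.subset_of_finClique hLS hm.1.1 hm.1.2.2.1 (by omega))
  · intro m hm
    rw [mem_linesOf] at hm
    obtain ⟨ℓ, hℓ, hmℓ⟩ := hm.2.2.1.exists_isLineOf (hm.1.trans hAC) hm.2.1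
    have hsub : m ⊆ ℓ ∩ A := Finset.subset_inter hmℓ hm.1
    refine ⟨ℓ, Finset.mem_filter.2 ⟨mem_linesOf.2 hℓ, hm.2.1.trans (Finset.card_le_card hsub)⟩, ?_⟩
    exact hm.2.2.2 _ Finset.inter_subset_right (hℓ.2.2.1.mono Finset.inter_subset_left) hsub
  · intro ℓ hℓ
    have := (Finset.mem_filter.1 hℓ).2
    push_cast [show 2 ≤ (ℓ ∩ A).card by omega]
    rfl

/-- Adjoining a point on a line based in `B` does not increase the predimension. -/
theorem delta_insert_le (hLS : IsLinearSpace R) {B C ℓ : Finset M} {c : M} (hBC : B ⊆ C)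
    (hℓ : ℓ ∈ linesOf R C) (hcℓ : c ∈ ℓ) (hcB : c ∉ B) (h : 2 ≤ (ℓ ∩ B).card) :
    delta R (insert c B) ≤ delta R B := by
  have hcC : c ∈ C := (mem_linesOf.1 hℓ).1 hcℓ
  rw [delta_eq_of_subset hLS (Finset.insert_subset hcC hBC), delta_eq_of_subset hLS hBC,
    Finset.card_insert_of_notMem hcB]
  have hlt : ∑ m ∈ linesOf R C, ((m ∩ B).card - 2) <
      ∑ m ∈ linesOf R C, ((m ∩ insert c B).card - 2) := by
    refine Finset.sum_lt_sum (fun m _ => ?_) ⟨ℓ, hℓ, ?_⟩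
    · exact Nat.sub_le_sub_right (Finset.card_le_card
        (Finset.inter_subset_inter_left (Finset.subset_insert c B))) 2
    · rw [Finset.inter_insert_of_mem hcℓ, Finset.card_insert_of_notMem (by simp [hcB])]
      omega
  omega

/-- Removing a point that lies on at most one line does not increase the predimension. -/
theorem delta_erase_le (hLS : IsLinearSpace R) {C : Finset M} {c : M} (hc : c ∈ C)
    (h : ((linesOf R C).filter (c ∈ ·)).card ≤ 1) : delta R (C.erase c) ≤ delta R C := by
  rw [delta_eq_of_subset hLS (C.erase_subset c), delta_eq_of_subset hLS (Finset.Subset.refl C)]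
  have hle : ∑ m ∈ linesOf R C, ((m ∩ C).card - 2) ≤
      ∑ m ∈ linesOf R C, (((m ∩ C.erase c).card - 2) + if c ∈ m then 1 else 0) := by
    refine Finset.sum_le_sum fun m _ => ?_
    rw [Finset.inter_erase]
    split_ifs with hcm
    · have := Finset.card_erase_add_one (Finset.mem_inter.2 ⟨hcm, hc⟩)
      omega
    · rw [Finset.erase_eq_of_notMem (by simp [hcm])]
      omega
  rw [Finset.sum_add_distrib, ← Finset.card_filter] at hle
  have := Finset.card_erase_add_one hc
  omega

/-- A primitive extension has no intermediate set whose predimension is at most that of the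
base. -/
theorem PrimitiveExt.not_delta_le {A B C : Finset M} (hprim : PrimitiveExt R B C) (hBA : B ⊂ A)
    (hAC : A ⊂ C) : ¬ delta R A ≤ delta R B := fun h =>
  hprim.2 ⟨A, hBA, hAC, ⟨hBA.1, fun X hBX hXA => hprim.1.2 X hBX (hXA.trans hAC.1)⟩,
    hAC.1, fun X hAX hXC => h.trans (hprim.1.2 X (hBA.1.trans hAX) hXC)⟩

theorem PrimitiveExt.card_inter_le_one (hLS : IsLinearSpace R) {B C ℓ : Finset M}
    (hprim : PrimitiveExt R B C) (hcard : 2 ≤ (C \ B).card) (hℓ : ℓ ∈ linesOf R C)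
    (hne : (ℓ ∩ (C \ B)).Nonempty) : (ℓ ∩ B).card ≤ 1 := by
  obtain ⟨c, hc⟩ := hne
  rw [Finset.mem_inter, Finset.mem_sdiff] at hc
  obtain ⟨hcℓ, hcC, hcB⟩ := hc
  by_contra! h
  refine hprim.not_delta_le (Finset.ssubset_insert hcB) ?_
    (delta_insert_le hLS hprim.1.1 hℓ hcℓ hcB h)
  refine (Finset.insert_subset hcC hprim.1.1).ssubset_of_ne fun heq => ?_
  rw [← heq, Finset.card_sdiff_of_subset (Finset.subset_insert c B),
    Finset.card_insert_of_notMem hcB] at hcard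
  omega

end LinearSpace

/-- If `C ∈ K₀` is a primitive extension of `B` with `|C \ B| ≥ 2`, then every
nontrivial line of `C` meeting `C \ B` has at most one point in `B`; and if moreover
`δ(C) = δ(B)`, every point of `C \ B` lies on at least two distinct lines of `C`
based in `C \ B`. -/
theorem primitive_lines_meet_base_once {M : Type*} (R : M → M → M → Prop)
    (hLS : IsLinearSpace R) (B C : Finset M) (hK0 : InK0 R C)
    (hprim : PrimitiveExt R B C) (hcard : 2 ≤ (C \ B).card) :
    (∀ ℓ ∈ linesOf R C, (ℓ ∩ (C \ B)).Nonempty → (ℓ ∩ B).card ≤ 1) ∧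
    (delta R C = delta R B →
      ∀ c ∈ C \ B, ∃ ℓ₁ ∈ linesOf R C, ∃ ℓ₂ ∈ linesOf R C, ℓ₁ ≠ ℓ₂ ∧
        c ∈ ℓ₁ ∧ c ∈ ℓ₂ ∧ 2 ≤ (ℓ₁ ∩ (C \ B)).card ∧ 2 ≤ (ℓ₂ ∩ (C \ B)).card) := by
  refine ⟨fun ℓ hℓ hne => hprim.card_inter_le_one hLS hcard hℓ hne, fun hδ c hc => ?_⟩
  have hBC := hprim.1.1
  have hcCB := Finset.mem_sdiff.1 hc
  have based : ∀ ℓ ∈ linesOf R C, c ∈ ℓ → 2 ≤ (ℓ ∩ (C \ B)).card := by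
    intro ℓ hℓ hcℓ
    have hB := hprim.card_inter_le_one hLS hcard hℓ ⟨c, Finset.mem_inter.2 ⟨hcℓ, hc⟩⟩
    have hline := mem_linesOf.1 hℓ
    have h3 := hline.2.1
    have hsplit := Finset.card_inter_add_card_sdiff ℓ B
    rw [← Finset.inter_sdiff_assoc, Finset.inter_eq_left.2 hline.1]
    omega
  have htwo : 1 < ((linesOf R C).filter (c ∈ ·)).card := by
    by_contra! h
    refine hprim.not_delta_le (A := C.erase c) ?_ (Finset.erase_ssubset hcCB.1)
      (hδ ▸ delta_erase_le hLS hcCB.1 h)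
    refine Finset.ssubset_iff_subset_ne.2 ⟨Finset.subset_erase.2 ⟨hBC, hcCB.2⟩, fun heq => ?_⟩
    have h1 := Finset.card_erase_add_one hcCB.1
    rw [← heq] at h1
    rw [Finset.card_sdiff_of_subset hBC] at hcard
    omega
  obtain ⟨ℓ₁, h₁, ℓ₂, h₂, hne⟩ := Finset.one_lt_card.1 htwo
  rw [Finset.mem_filter] at h₁ h₂
  exact ⟨ℓ₁, h₁.1, ℓ₂, h₂.1, hne, h₁.2, h₂.2, based ℓ₁ h₁.1 h₁.2, based ℓ₂ h₂.1 h₂.2⟩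
end

section
/- Let D, E, F ∈ K₀ with E ∩ F = D and D ≤ E, and let G = F ⊕_D E be the free amalgam of F and E over D. Then: (1) G is a linear space (any two distinct points of G lie on at most one nontrivial line) and G ∈ K₀; (2) δ(G) = δ(E) + δ(F) − δ(D); and (3) F ≤ G. -/
open scoped Classical

/-- The restriction of the ternary relation `S` to the set `X`. -/
def RestrictLS {M : Type*} (S : M → M → M → Prop) (X : Finset M) : M → M → M → Prop :=
  fun a b c => a ∈ X ∧ b ∈ X ∧ c ∈ X ∧ S a b c

/-- `x` lies on the line through `d₁, d₂` (computed in `E` or in `F`), or is one of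
`d₁, d₂`. -/
def colWith {M : Type*} (S : M → M → M → Prop) (E F : Finset M) (d₁ d₂ x : M) : Prop :=
  x = d₁ ∨ x = d₂ ∨ (x ∈ E ∧ S d₁ d₂ x) ∨ (x ∈ F ∧ S d₁ d₂ x)

/-- The collinearity relation of the free amalgam `G = F ⊕_D E`: the given relations
inside `E` and inside `F`, and additionally points of `E \ D` and `F \ D` are collinear
exactly when they lie on a common line based in `D`. -/
def amalgamRel {M : Type*} (S : M → M → M → Prop) (D E F : Finset M) :
    M → M → M → Prop :=
  fun a b c =>
    (a ∈ E ∧ b ∈ E ∧ c ∈ E ∧ S a b c) ∨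
    (a ∈ F ∧ b ∈ F ∧ c ∈ F ∧ S a b c) ∨
    (a ∈ E ∪ F ∧ b ∈ E ∪ F ∧ c ∈ E ∪ F ∧ a ≠ b ∧ b ≠ c ∧ a ≠ c ∧
      ∃ d₁ ∈ D, ∃ d₂ ∈ D, d₁ ≠ d₂ ∧
        colWith S E F d₁ d₂ a ∧ colWith S E F d₁ d₂ b ∧ colWith S E F d₁ d₂ c)

/-- `x` lies on the line through `p` and `q`, the points `p` and `q` included. -/
def OnLine {M : Type*} (R : M → M → M → Prop) (p q x : M) : Prop :=
  x = p ∨ x = q ∨ R p q x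

/-- The points of `A` on the line through `p` and `q`. -/
noncomputable def lineThrough {M : Type*} (R : M → M → M → Prop) (A : Finset M) (p q : M) :
    Finset M :=
  A.filter (OnLine R p q)

namespace IsLinearSpace

variable {M : Type*} {R : M → M → M → Prop}

theorem collinear_of_onLine (h : IsLinearSpace R) {p q a b c : M} (hpq : p ≠ q)
    (ha : OnLine R p q a) (hb : OnLine R p q b) (hc : OnLine R p q c)
    (hab : a ≠ b) (hbc : b ≠ c) (hac : a ≠ c) : R a b c := by
  have h1 := @h.swap12
  have h2 := @h.swap23
  have h3 := @h.line
  have key : ∀ {x y : M}, R p q x → R p q y → x ≠ y → R p x y := fun hx hy hxy =>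
    h2 (h3 hx hy hxy)
  have key' : ∀ {x y : M}, R p q x → R p q y → x ≠ y → R q x y := fun hx hy hxy =>
    h2 (h3 (h1 hx) (h1 hy) hxy)
  rcases ha with rfl | rfl | ha <;> rcases hb with rfl | rfl | hb <;>
    rcases hc with rfl | rfl | hc
  all_goals try exact absurd rfl ‹_›
  · exact hc
  · exact h2 hb
  · exact key hb hc hbc
  · exact h1 hc
  · exact h2 (h1 hb)
  · exact key' hb hc hbc
  · exact h1 (h2 ha)
  · exact h1 (key ha hc hac)
  · exact h2 (h1 (h2 ha))
  · exact h1 (key' ha hc hac)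
  · exact h2 (h1 (key ha hb hab))
  · exact h2 (h1 (key' ha hb hab))
  · have e1 := key ha hb hab
    have e2 := key ha hc hac
    exact h2 (h3 (h1 e1) (h1 e2) hbc)

theorem onLine_of_mem_of_mem (h : IsLinearSpace R) {p q a b c : M} (hpq : p ≠ q) (hab : a ≠ b)
    (ha : OnLine R p q a) (hb : OnLine R p q b) (hc : OnLine R p q c) : OnLine R a b c := by
  by_cases h1 : c = a
  · exact Or.inl h1
  by_cases h2 : c = b
  · exact Or.inr (Or.inl h2)
  exact Or.inr (Or.inr (h.collinear_of_onLine hpq ha hb hc hab (Ne.symm h2) (Ne.symm h1)))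

theorem onLine_trans (h : IsLinearSpace R) {p q a b c : M} (hpq : p ≠ q) (hab : a ≠ b)
    (ha : OnLine R p q a) (hb : OnLine R p q b) (hc : OnLine R a b c) : OnLine R p q c :=
  h.onLine_of_mem_of_mem hab hpq (h.onLine_of_mem_of_mem hpq hab ha hb (Or.inl rfl))
    (h.onLine_of_mem_of_mem hpq hab ha hb (Or.inr (Or.inl rfl))) hc

end IsLinearSpace

section Lines

variable {M : Type*} {R : M → M → M → Prop}

theorem mem_lineThrough {A : Finset M} {p q x : M} :
    x ∈ lineThrough R A p q ↔ x ∈ A ∧ OnLine R p q x := by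
  simp [lineThrough]

theorem finClique_lineThrough (h : IsLinearSpace R) (A : Finset M) {p q : M} (hpq : p ≠ q) :
    FinClique R (lineThrough R A p q) := fun _ ha _ hb _ hc hab hbc hac =>
  h.collinear_of_onLine hpq (mem_lineThrough.1 ha).2 (mem_lineThrough.1 hb).2
    (mem_lineThrough.1 hc).2 hab hbc hac

theorem FinClique.subset_lineThrough {A X : Finset M} (hX : FinClique R X) (hXA : X ⊆ A)
    {p q : M} (hpq : p ≠ q) (hp : p ∈ X) (hq : q ∈ X) : X ⊆ lineThrough R A p q := by
  intro x hx
  refine mem_lineThrough.2 ⟨hXA hx, ?_⟩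
  by_cases h1 : x = p
  · exact Or.inl h1
  by_cases h2 : x = q
  · exact Or.inr (Or.inl h2)
  exact Or.inr (Or.inr (hX p hp q hq x hx hpq (Ne.symm h2) (Ne.symm h1)))

theorem IsLineOf.eq_lineThrough (h : IsLinearSpace R) {A ℓ : Finset M} (hℓ : IsLineOf R A ℓ)
    {p q : M} (hpq : p ≠ q) (hp : p ∈ ℓ) (hq : q ∈ ℓ) : ℓ = lineThrough R A p q :=
  (hℓ.2.2.2 _ (Finset.filter_subset _ _) (finClique_lineThrough h A hpq)
    (hℓ.2.2.1.subset_lineThrough hℓ.1 hpq hp hq)).symm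

theorem isLineOf_lineThrough (h : IsLinearSpace R) {A : Finset M} {p q : M} (hpq : p ≠ q)
    (hp : p ∈ A) (hq : q ∈ A) (hcard : 3 ≤ (lineThrough R A p q).card) :
    IsLineOf R A (lineThrough R A p q) := by
  refine ⟨Finset.filter_subset _ _, hcard, finClique_lineThrough h A hpq, ?_⟩
  intro ℓ' hA hc hsub
  refine (hc.subset_lineThrough hA hpq (hsub ?_) (hsub ?_)).antisymm hsub
  · exact mem_lineThrough.2 ⟨hp, Or.inl rfl⟩
  · exact mem_lineThrough.2 ⟨hq, Or.inr (Or.inl rfl)⟩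

theorem exists_isLineOf_of_rel (h : IsLinearSpace R) {A : Finset M} {p q x : M}
    (hp : p ∈ A) (hq : q ∈ A) (hx : x ∈ A) (hR : R p q x) :
    ∃ ℓ, IsLineOf R A ℓ ∧ p ∈ ℓ ∧ q ∈ ℓ ∧ x ∈ ℓ := by
  have h1 : p ∈ lineThrough R A p q := mem_lineThrough.2 ⟨hp, Or.inl rfl⟩
  have h2 : q ∈ lineThrough R A p q := mem_lineThrough.2 ⟨hq, Or.inr (Or.inl rfl)⟩
  have h3 : x ∈ lineThrough R A p q := mem_lineThrough.2 ⟨hx, Or.inr (Or.inr hR)⟩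
  refine ⟨_, isLineOf_lineThrough h (h.ne12 hR) hp hq ?_, h1, h2, h3⟩
  exact Finset.two_lt_card.2 ⟨p, h1, q, h2, x, h3, h.ne12 hR, h.ne13 hR, h.ne23 hR⟩

theorem lineThrough_inter {A G : Finset M} (hA : A ⊆ G) (p q : M) :
    lineThrough R G p q ∩ A = lineThrough R A p q := by
  ext x
  simp only [Finset.mem_inter, mem_lineThrough]
  exact ⟨fun hx => ⟨hx.2, hx.1.2⟩, fun hx => ⟨⟨hA hx.1, hx.2⟩, hx.1⟩⟩

theorem linesOf_eq_image (h : IsLinearSpace R) {A G : Finset M} (hA : A ⊆ G) :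
    linesOf R A =
      ((linesOf R G).filter fun ℓ => 3 ≤ (ℓ ∩ A).card).image fun ℓ => ℓ ∩ A := by
  ext ℓ
  simp only [Finset.mem_image, Finset.mem_filter, mem_linesOf]
  constructor
  · intro hℓ
    obtain ⟨p, hp, q, hq, hpq⟩ := Finset.one_lt_card.1 (lt_of_lt_of_le (by norm_num) hℓ.2.1)
    have he := hℓ.eq_lineThrough h hpq hp hq
    have hi := lineThrough_inter (R := R) hA p q
    rw [← he] at hi
    refine ⟨lineThrough R G p q,
      ⟨isLineOf_lineThrough h hpq (hA (hℓ.1 hp)) (hA (hℓ.1 hq)) ?_, ?_⟩, hi⟩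
    · refine hℓ.2.1.trans (Finset.card_le_card ?_)
      exact hi ▸ Finset.inter_subset_left
    · rw [hi]; exact hℓ.2.1
  · rintro ⟨k, ⟨hk, hcard⟩, rfl⟩
    obtain ⟨p, hp, q, hq, hpq⟩ := Finset.one_lt_card.1 (lt_of_lt_of_le (by norm_num) hcard)
    rw [Finset.mem_inter] at hp hq
    rw [hk.eq_lineThrough h hpq hp.1 hq.1, lineThrough_inter hA] at hcard ⊢
    exact isLineOf_lineThrough h hpq hp.2 hq.2 hcard

/-- The predimension of a subset computed from the lines of the ambient linear space. -/
theorem delta_eq_sum (h : IsLinearSpace R) {A G : Finset M} (hA : A ⊆ G) :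
    delta R A = (A.card : ℤ) - ∑ ℓ ∈ linesOf R G, (((ℓ ∩ A).card - 2 : ℕ) : ℤ) := by
  rw [delta, linesOf_eq_image h hA, Finset.sum_image, Finset.sum_filter]
  · congr 1
    refine Finset.sum_congr rfl fun ℓ _ => ?_
    split_ifs <;> omega
  · intro k hk l hl (hkl : k ∩ A = l ∩ A)
    rw [Finset.mem_coe, Finset.mem_filter, mem_linesOf] at hk hl
    obtain ⟨p, hp, q, hq, hpq⟩ :=
      Finset.one_lt_card.1 (lt_of_lt_of_le (by norm_num) hk.2)
    have hp' : p ∈ l ∩ A := hkl ▸ hp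
    have hq' : q ∈ l ∩ A := hkl ▸ hq
    rw [Finset.mem_inter] at hp hq hp' hq'
    rw [hk.1.eq_lineThrough h hpq hp.1 hq.1, hl.1.eq_lineThrough h hpq hp'.1 hq'.1]

theorem card_line_inter_union (ℓ A B : Finset M) :
    (ℓ ∩ (A ∪ B)).card + (ℓ ∩ (A ∩ B)).card = (ℓ ∩ A).card + (ℓ ∩ B).card := by
  rw [Finset.inter_union_distrib_left, Finset.inter_inter_distrib_left]
  exact Finset.card_union_add_card_inter _ _

theorem delta_submodular (h : IsLinearSpace R) (A B : Finset M) :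
    delta R (A ∪ B) + delta R (A ∩ B) ≤ delta R A + delta R B := by
  have hI : A ∩ B ⊆ A ∪ B := Finset.inter_subset_left.trans Finset.subset_union_left
  rw [delta_eq_sum h (Finset.Subset.refl (A ∪ B)), delta_eq_sum h hI,
    delta_eq_sum h (Finset.subset_union_left (s₁ := A) (s₂ := B)),
    delta_eq_sum h (Finset.subset_union_right (s₁ := A) (s₂ := B))]
  have hc := Finset.card_union_add_card_inter A B
  have hs : ∑ ℓ ∈ linesOf R (A ∪ B), (((ℓ ∩ A).card - 2 : ℕ) : ℤ) +
      ∑ ℓ ∈ linesOf R (A ∪ B), (((ℓ ∩ B).card - 2 : ℕ) : ℤ) ≤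
      ∑ ℓ ∈ linesOf R (A ∪ B), (((ℓ ∩ (A ∪ B)).card - 2 : ℕ) : ℤ) +
      ∑ ℓ ∈ linesOf R (A ∪ B), (((ℓ ∩ (A ∩ B)).card - 2 : ℕ) : ℤ) := by
    rw [← Finset.sum_add_distrib, ← Finset.sum_add_distrib]
    refine Finset.sum_le_sum fun ℓ _ => ?_
    have h1 := card_line_inter_union ℓ A B
    have h2 : (ℓ ∩ A).card ≤ (ℓ ∩ (A ∪ B)).card :=
      Finset.card_le_card (Finset.inter_subset_inter_left Finset.subset_union_left)
    have h3 : (ℓ ∩ B).card ≤ (ℓ ∩ (A ∪ B)).card :=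
      Finset.card_le_card (Finset.inter_subset_inter_left Finset.subset_union_right)
    omega
  omega

/-- If every line meeting both `A \ B` and `B \ A` is based in `A ∩ B`, then `δ` is modular
at `A` and `B`. -/
theorem delta_modular (h : IsLinearSpace R) {A B : Finset M}
    (hAB : ∀ ℓ ∈ linesOf R (A ∪ B), ∀ x ∈ ℓ, ∀ y ∈ ℓ, x ∉ B → y ∉ A →
      2 ≤ (ℓ ∩ (A ∩ B)).card) :
    delta R (A ∪ B) + delta R (A ∩ B) = delta R A + delta R B := by
  have hI : A ∩ B ⊆ A ∪ B := Finset.inter_subset_left.trans Finset.subset_union_left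
  rw [delta_eq_sum h (Finset.Subset.refl (A ∪ B)), delta_eq_sum h hI,
    delta_eq_sum h (Finset.subset_union_left (s₁ := A) (s₂ := B)),
    delta_eq_sum h (Finset.subset_union_right (s₁ := A) (s₂ := B))]
  have hc := Finset.card_union_add_card_inter A B
  have hs : ∑ ℓ ∈ linesOf R (A ∪ B), (((ℓ ∩ A).card - 2 : ℕ) : ℤ) +
      ∑ ℓ ∈ linesOf R (A ∪ B), (((ℓ ∩ B).card - 2 : ℕ) : ℤ) =
      ∑ ℓ ∈ linesOf R (A ∪ B), (((ℓ ∩ (A ∪ B)).card - 2 : ℕ) : ℤ) +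
      ∑ ℓ ∈ linesOf R (A ∪ B), (((ℓ ∩ (A ∩ B)).card - 2 : ℕ) : ℤ) := by
    rw [← Finset.sum_add_distrib, ← Finset.sum_add_distrib]
    refine Finset.sum_congr rfl fun ℓ hℓ => ?_
    have h1 := card_line_inter_union ℓ A B
    have h2 : (ℓ ∩ (A ∩ B)).card ≤ (ℓ ∩ A).card :=
      Finset.card_le_card (Finset.inter_subset_inter_left Finset.inter_subset_left)
    have h3 : (ℓ ∩ (A ∩ B)).card ≤ (ℓ ∩ B).card :=
      Finset.card_le_card (Finset.inter_subset_inter_left Finset.inter_subset_right)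
    by_cases hB : ℓ ⊆ B
    · have e1 : ℓ ∩ B = ℓ := Finset.inter_eq_left.2 hB
      have e2 : ℓ ∩ (A ∪ B) = ℓ :=
        Finset.inter_eq_left.2 (hB.trans Finset.subset_union_right)
      rw [e1, e2] at h1 ⊢
      omega
    by_cases hA : ℓ ⊆ A
    · have e1 : ℓ ∩ A = ℓ := Finset.inter_eq_left.2 hA
      have e2 : ℓ ∩ (A ∪ B) = ℓ :=
        Finset.inter_eq_left.2 (hA.trans Finset.subset_union_left)
      rw [e1, e2] at h1 ⊢
      omega
    obtain ⟨x, hx, hxB⟩ := Finset.not_subset.1 hB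
    obtain ⟨y, hy, hyA⟩ := Finset.not_subset.1 hA
    have h4 := hAB ℓ hℓ x hx y hy hxB hyA
    omega
  omega

theorem finClique_congr {R' : M → M → M → Prop} {A X : Finset M}
    (hR : ∀ a ∈ A, ∀ b ∈ A, ∀ c ∈ A, R a b c ↔ R' a b c) (hX : X ⊆ A) :
    FinClique R X ↔ FinClique R' X := by
  constructor <;> intro h a ha b hb c hc h1 h2 h3
  · exact (hR a (hX ha) b (hX hb) c (hX hc)).1 (h a ha b hb c hc h1 h2 h3)
  · exact (hR a (hX ha) b (hX hb) c (hX hc)).2 (h a ha b hb c hc h1 h2 h3)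

theorem delta_congr {R' : M → M → M → Prop} {A : Finset M}
    (hR : ∀ a ∈ A, ∀ b ∈ A, ∀ c ∈ A, R a b c ↔ R' a b c) : delta R A = delta R' A := by
  have : linesOf R A = linesOf R' A := by
    ext ℓ
    simp only [mem_linesOf, IsLineOf]
    refine and_congr_right fun hℓ => and_congr_right fun _ =>
      and_congr (finClique_congr hR hℓ) ?_
    exact forall_congr' fun ℓ' => forall_congr' fun h' => by rw [finClique_congr hR h']
  rw [delta, delta, this]

theorem delta_restrictLS {S : M → M → M → Prop} {A X : Finset M} (hA : A ⊆ X) :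
    delta (RestrictLS S X) A = delta S A :=
  delta_congr fun _ ha _ hb _ hc => ⟨fun h => h.2.2.2, fun h => ⟨hA ha, hA hb, hA hc, h⟩⟩

theorem onLine_restrictLS {S : M → M → M → Prop} {X : Finset M} {p q x : M}
    (hp : p ∈ X) (hq : q ∈ X) (hx : x ∈ X) :
    OnLine (RestrictLS S X) p q x ↔ OnLine S p q x := by
  simp [OnLine, RestrictLS, hp, hq, hx]

/-- If `D` is strong in `E`, a point outside `D` lies on at most one line based in `D`. -/
theorem Strong.onLine_of_rel {D E : Finset M} (h : IsLinearSpace R) (hDE : Strong R D E)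
    {a d₁ d₂ e₁ e₂ : M} (ha : a ∈ E) (haD : a ∉ D) (hd₁ : d₁ ∈ D) (hd₂ : d₂ ∈ D)
    (he₁ : e₁ ∈ D) (he₂ : e₂ ∈ D) (hd : R d₁ d₂ a) (he : R e₁ e₂ a) :
    OnLine R d₁ d₂ e₁ := by
  obtain ⟨k, hk, kd₁, kd₂, ka⟩ := exists_isLineOf_of_rel h (hDE.1 hd₁) (hDE.1 hd₂) ha hd
  obtain ⟨l, hl, le₁, le₂, la⟩ := exists_isLineOf_of_rel h (hDE.1 he₁) (hDE.1 he₂) ha he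
  by_cases hkl : k = l
  · subst hkl
    rw [hk.eq_lineThrough h (h.ne12 hd) kd₁ kd₂] at le₁
    exact (mem_lineThrough.1 le₁).2
  exfalso
  have hins : insert a D ⊆ E := Finset.insert_subset ha hDE.1
  have hle := hDE.2 (insert a D) (Finset.subset_insert a D) hins
  rw [delta_eq_sum h hDE.1, delta_eq_sum h hins, Finset.card_insert_of_notMem haD] at hle
  have hstep : ∀ m : Finset M, a ∈ m → ∀ p ∈ m, ∀ q ∈ m, p ∈ D → q ∈ D → p ≠ q →
      (m ∩ insert a D).card - 2 = (m ∩ D).card - 2 + 1 := by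
    intro m hm p hp q hq hpD hqD hpq
    have h1 : 1 < (m ∩ D).card := Finset.one_lt_card.2
      ⟨p, Finset.mem_inter.2 ⟨hp, hpD⟩, q, Finset.mem_inter.2 ⟨hq, hqD⟩, hpq⟩
    rw [Finset.inter_insert_of_mem hm, Finset.card_insert_of_notMem
      (fun hc => haD (Finset.mem_inter.1 hc).2)]
    omega
  have hsum : ∑ m ∈ linesOf R E, ((((m ∩ D).card - 2 : ℕ) : ℤ) +
      ((if m = k then 1 else 0) + (if m = l then 1 else 0))) ≤
      ∑ m ∈ linesOf R E, (((m ∩ insert a D).card - 2 : ℕ) : ℤ) := by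
    refine Finset.sum_le_sum fun m _ => ?_
    by_cases h1 : m = k
    · subst h1
      have := hstep m ka d₁ kd₁ d₂ kd₂ hd₁ hd₂ (h.ne12 hd)
      simp only [if_true, if_neg hkl]
      omega
    by_cases h2 : m = l
    · subst h2
      have := hstep m la e₁ le₁ e₂ le₂ he₁ he₂ (h.ne12 he)
      simp only [if_true, if_neg h1]
      omega
    have : (m ∩ D).card ≤ (m ∩ insert a D).card :=
      Finset.card_le_card (Finset.inter_subset_inter_left (Finset.subset_insert a D))
    simp only [if_neg h1, if_neg h2]
    omega
  rw [Finset.sum_add_distrib, Finset.sum_add_distrib, Finset.sum_ite_eq', Finset.sum_ite_eq',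
    if_pos (mem_linesOf.2 hk), if_pos (mem_linesOf.2 hl)] at hsum
  push_cast at hle
  linarith

end Lines

section Amalgam

variable {M : Type*} {S : M → M → M → Prop} {D E F : Finset M}

theorem colWith_iff_onLine {p q x : M} (hx : x ∈ E ∪ F) :
    colWith S E F p q x ↔ OnLine S p q x := by
  rw [Finset.mem_union] at hx
  unfold colWith OnLine
  tauto

/-- Collinearity along a line based in `D`. -/
def CollinearOver (S : M → M → M → Prop) (D : Finset M) (a b c : M) : Prop :=
  ∃ d₁ ∈ D, ∃ d₂ ∈ D, d₁ ≠ d₂ ∧ OnLine S d₁ d₂ a ∧ OnLine S d₁ d₂ b ∧ OnLine S d₁ d₂ c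

theorem amalgamRel_iff {a b c : M} :
    amalgamRel S D E F a b c ↔
      RestrictLS S E a b c ∨ RestrictLS S F a b c ∨
        (a ∈ E ∪ F ∧ b ∈ E ∪ F ∧ c ∈ E ∪ F ∧ a ≠ b ∧ b ≠ c ∧ a ≠ c ∧
          CollinearOver S D a b c) := by
  refine or_congr Iff.rfl (or_congr Iff.rfl ?_)
  refine and_congr_right fun ha => and_congr_right fun hb => and_congr_right fun hc => ?_
  simp only [colWith_iff_onLine ha, colWith_iff_onLine hb, colWith_iff_onLine hc, CollinearOver]

theorem rel_of_collinearOver {X : Finset M} (h : IsLinearSpace (RestrictLS S X)) (hD : D ⊆ X)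
    {a b c : M} (ha : a ∈ X) (hb : b ∈ X) (hc : c ∈ X) (hab : a ≠ b) (hbc : b ≠ c)
    (hac : a ≠ c) (hcol : CollinearOver S D a b c) : S a b c := by
  obtain ⟨p, hp, q, hq, hpq, h1, h2, h3⟩ := hcol
  rw [← onLine_restrictLS (hD hp) (hD hq) ‹_›] at h1 h2 h3
  exact (h.collinear_of_onLine hpq h1 h2 h3 hab hbc hac).2.2.2

theorem onLine_trans_of_mem {X : Finset M} (h : IsLinearSpace (RestrictLS S X))
    {p q a b c : M} (hp : p ∈ X) (hq : q ∈ X) (ha : a ∈ X) (hb : b ∈ X) (hc : c ∈ X)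
    (hpq : p ≠ q) (hab : a ≠ b) (h1 : OnLine S p q a) (h2 : OnLine S p q b)
    (h3 : OnLine S a b c) : OnLine S p q c := by
  rw [← onLine_restrictLS ‹_› ‹_› ‹_›] at h1 h2 h3 ⊢
  exact h.onLine_trans hpq hab h1 h2 h3

theorem amalgamRel_iff_of_mem {X : Finset M} (hE : IsLinearSpace (RestrictLS S E))
    (hF : IsLinearSpace (RestrictLS S F)) (hEF : E ∩ F = D) (hX : X = E ∨ X = F) {a b c : M}
    (ha : a ∈ X) (hb : b ∈ X) (hc : c ∈ X) : amalgamRel S D E F a b c ↔ S a b c := by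
  have hDE : D ⊆ E := hEF ▸ Finset.inter_subset_left
  have hDF : D ⊆ F := hEF ▸ Finset.inter_subset_right
  rw [amalgamRel_iff]
  constructor
  · rintro (h | h | ⟨-, -, -, h1, h2, h3, h⟩)
    · exact h.2.2.2
    · exact h.2.2.2
    · rcases hX with rfl | rfl
      · exact rel_of_collinearOver hE hDE ha hb hc h1 h2 h3 h
      · exact rel_of_collinearOver hF hDF ha hb hc h1 h2 h3 h
  · rcases hX with rfl | rfl
    · exact fun h => Or.inl ⟨ha, hb, hc, h⟩
    · exact fun h => Or.inr (Or.inl ⟨ha, hb, hc, h⟩)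

theorem Strong.restrictLS (hDE : Strong S D E) : Strong (RestrictLS S E) D E :=
  ⟨hDE.1, fun X hX hXE => by
    rw [delta_restrictLS hDE.1, delta_restrictLS hXE]
    exact hDE.2 X hX hXE⟩

/-- Two lines based in `D` that share two points of the amalgam coincide: the base points of
one lie on the other. -/
theorem onLine_base (hE : IsLinearSpace (RestrictLS S E)) (hF : IsLinearSpace (RestrictLS S F))
    (hEF : E ∩ F = D) (hDE : Strong S D E) {a b d₁ d₂ e₁ e₂ : M}
    (ha : a ∈ E ∪ F) (hb : b ∈ E ∪ F) (hab : a ≠ b)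
    (hd₁ : d₁ ∈ D) (hd₂ : d₂ ∈ D) (he₁ : e₁ ∈ D) (he₂ : e₂ ∈ D)
    (hd : d₁ ≠ d₂) (he : e₁ ≠ e₂)
    (had : OnLine S d₁ d₂ a) (hbd : OnLine S d₁ d₂ b)
    (hae : OnLine S e₁ e₂ a) (hbe : OnLine S e₁ e₂ b) : OnLine S d₁ d₂ e₁ := by
  have hDF : D ⊆ F := hEF ▸ Finset.inter_subset_right
  have outside : ∀ x ∈ E ∪ F, x ∉ F → OnLine S d₁ d₂ x → OnLine S e₁ e₂ x →
      OnLine S d₁ d₂ e₁ := by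
    intro x hx hxF hxd hxe
    have hxE : x ∈ E := (Finset.mem_union.1 hx).resolve_right hxF
    have hxD : x ∉ D := fun h => hxF (hDF h)
    have rel : ∀ {p q : M}, p ∈ D → q ∈ D → OnLine S p q x → RestrictLS S E p q x := by
      rintro p q hp hq (rfl | rfl | h)
      · exact absurd hp hxD
      · exact absurd hq hxD
      · exact ⟨hDE.1 hp, hDE.1 hq, hxE, h⟩
    rw [← onLine_restrictLS (hDE.1 hd₁) (hDE.1 hd₂) (hDE.1 he₁)]
    exact hDE.restrictLS.onLine_of_rel hE hxE hxD hd₁ hd₂ he₁ he₂ (rel hd₁ hd₂ hxd)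
      (rel he₁ he₂ hxe)
  by_cases haF : a ∈ F
  · by_cases hbF : b ∈ F
    · refine onLine_trans_of_mem hF (hDF hd₁) (hDF hd₂) haF hbF (hDF he₁) hd hab had hbd ?_
      rw [← onLine_restrictLS ‹_› ‹_› (hDF he₁)]
      rw [← onLine_restrictLS (hDF he₁) (hDF he₂) ‹_›] at hae hbe
      exact hF.onLine_of_mem_of_mem he hab hae hbe (Or.inl rfl)
    · exact outside b hb hbF hbd hbe
  · exact outside a ha haF had hae

theorem isLinearSpace_amalgamRel (hE : IsLinearSpace (RestrictLS S E))
    (hF : IsLinearSpace (RestrictLS S F)) (hEF : E ∩ F = D) (hDE : Strong S D E) :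
    IsLinearSpace (amalgamRel S D E F) := by
  have hDF : D ⊆ F := hEF ▸ Finset.inter_subset_right
  have swap : ∀ {p q x : M}, p ∈ D → q ∈ D → x ∈ E ∪ F → OnLine S p q x → OnLine S q p x := by
    rintro p q x hp hq hx (h | h | h)
    · exact Or.inr (Or.inl h)
    · exact Or.inl h
    · rcases Finset.mem_union.1 hx with hx | hx
      · exact Or.inr (Or.inr (hE.swap12 ⟨hDE.1 hp, hDE.1 hq, hx, h⟩).2.2.2)
      · exact Or.inr (Or.inr (hF.swap12 ⟨hDF hp, hDF hq, hx, h⟩).2.2.2)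
  have trans : ∀ {p q a b c : M}, p ∈ D → q ∈ D → p ≠ q → OnLine S p q a → OnLine S p q b →
      RestrictLS S E a b c ∨ RestrictLS S F a b c → OnLine S p q c := by
    rintro p q a b c hp hq hpq h1 h2 (h | h)
    · exact onLine_trans_of_mem hE (hDE.1 hp) (hDE.1 hq) h.1 h.2.1 h.2.2.1 hpq (hE.ne12 h)
        h1 h2 (Or.inr (Or.inr h.2.2.2))
    · exact onLine_trans_of_mem hF (hDF hp) (hDF hq) h.1 h.2.1 h.2.2.1 hpq (hF.ne12 h)
        h1 h2 (Or.inr (Or.inr h.2.2.2))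
  have ne12 : ∀ {a b c : M}, amalgamRel S D E F a b c → a ≠ b := by
    intro a b c h
    rcases amalgamRel_iff.1 h with h | h | h
    exacts [hE.ne12 h, hF.ne12 h, h.2.2.2.1]
  have ne23 : ∀ {a b c : M}, amalgamRel S D E F a b c → b ≠ c := by
    intro a b c h
    rcases amalgamRel_iff.1 h with h | h | h
    exacts [hE.ne23 h, hF.ne23 h, h.2.2.2.2.1]
  have ne13 : ∀ {a b c : M}, amalgamRel S D E F a b c → a ≠ c := by
    intro a b c h
    rcases amalgamRel_iff.1 h with h | h | h
    exacts [hE.ne13 h, hF.ne13 h, h.2.2.2.2.2.1]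
  have mem : ∀ {a b c : M}, amalgamRel S D E F a b c → a ∈ E ∪ F ∧ b ∈ E ∪ F ∧ c ∈ E ∪ F := by
    intro a b c h
    simp only [Finset.mem_union]
    rcases amalgamRel_iff.1 h with h | h | h
    · exact ⟨Or.inl h.1, Or.inl h.2.1, Or.inl h.2.2.1⟩
    · exact ⟨Or.inr h.1, Or.inr h.2.1, Or.inr h.2.2.1⟩
    · exact ⟨Finset.mem_union.1 h.1, Finset.mem_union.1 h.2.1, Finset.mem_union.1 h.2.2.1⟩
  refine ⟨ne12, ne23, ne13, ?_, ?_, ?_⟩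
  · intro a b c h
    rw [amalgamRel_iff] at h ⊢
    rcases h with h | h | ⟨ha, hb, hc, h1, h2, h3, p, hp, q, hq, hpq, h4, h5, h6⟩
    · exact Or.inl (hE.swap12 h)
    · exact Or.inr (Or.inl (hF.swap12 h))
    · exact Or.inr (Or.inr ⟨hb, ha, hc, h1.symm, h3, h2, p, hp, q, hq, hpq, h5, h4, h6⟩)
  · intro a b c h
    rw [amalgamRel_iff] at h ⊢
    rcases h with h | h | ⟨ha, hb, hc, h1, h2, h3, p, hp, q, hq, hpq, h4, h5, h6⟩
    · exact Or.inl (hE.swap23 h)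
    · exact Or.inr (Or.inl (hF.swap23 h))
    · exact Or.inr (Or.inr ⟨ha, hc, hb, h3, h2.symm, h1, p, hp, q, hq, hpq, h4, h6, h5⟩)
  · intro x y z w hz hw hzw
    have of_over : CollinearOver S D x w z → amalgamRel S D E F x w z := fun h =>
      amalgamRel_iff.2 (Or.inr (Or.inr ⟨(mem hz).1, (mem hw).2.2, (mem hz).2.2, ne13 hw,
        hzw.symm, ne13 hz, h⟩))
    have hxy := ne12 hz
    obtain ⟨hxm, hym, hzm⟩ := mem hz
    have hwm := (mem hw).2.2
    have based : ∀ {u v}, RestrictLS S E x y u → RestrictLS S F x y v →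
        x ∈ D ∧ y ∈ D := fun hu hv =>
      ⟨hEF ▸ Finset.mem_inter.2 ⟨hu.1, hv.1⟩, hEF ▸ Finset.mem_inter.2 ⟨hu.2.1, hv.2.1⟩⟩
    rcases or_assoc.2 (amalgamRel_iff.1 hz) with hz' | hz'
    · rcases or_assoc.2 (amalgamRel_iff.1 hw) with hw' | hw'
      · have mixed : x ∈ D → y ∈ D → amalgamRel S D E F x w z := fun hx hy =>
          of_over ⟨x, hx, y, hy, hxy, Or.inl rfl, Or.inr (Or.inr (hw'.elim (·.2.2.2) (·.2.2.2))),
            Or.inr (Or.inr (hz'.elim (·.2.2.2) (·.2.2.2)))⟩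
        rcases hz' with hz' | hz' <;> rcases hw' with hw' | hw'
        · exact amalgamRel_iff.2 (Or.inl (hE.line hz' hw' hzw))
        · exact mixed (based hz' hw').1 (based hz' hw').2
        · exact mixed (based hw' hz').1 (based hw' hz').2
        · exact amalgamRel_iff.2 (Or.inr (Or.inl (hF.line hz' hw' hzw)))
      · obtain ⟨-, -, -, -, -, -, p, hp, q, hq, hpq, h1, h2, h3⟩ := hw'
        exact of_over ⟨p, hp, q, hq, hpq, h1, h3, trans hp hq hpq h1 h2 hz'⟩
    · obtain ⟨-, -, -, -, -, -, p, hp, q, hq, hpq, h1, h2, h3⟩ := hz'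
      rcases or_assoc.2 (amalgamRel_iff.1 hw) with hw' | hw'
      · exact of_over ⟨p, hp, q, hq, hpq, h1, trans hp hq hpq h1 h2 hw', h3⟩
      · obtain ⟨-, -, -, -, -, -, r, hr, s, hs, hrs, k1, k2, k3⟩ := hw'
        have hr' : OnLine S p q r :=
          onLine_base hE hF hEF hDE hxm hym hxy hp hq hr hs hpq hrs h1 h2 k1 k2
        have hs' : OnLine S p q s :=
          onLine_base hE hF hEF hDE hxm hym hxy hp hq hs hr hpq hrs.symm h1 h2
            (swap hr hs hxm k1) (swap hr hs hym k2)
        refine of_over ⟨p, hp, q, hq, hpq, h1, ?_, h3⟩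
        rcases Finset.mem_union.1 hwm with hwE | hwF
        · exact onLine_trans_of_mem hE (hDE.1 hp) (hDE.1 hq) (hDE.1 hr) (hDE.1 hs) hwE hpq hrs
            hr' hs' k3
        · exact onLine_trans_of_mem hF (hDF hp) (hDF hq) (hDF hr) (hDF hs) hwF hpq hrs
            hr' hs' k3

/-- The predimension of a part of the amalgam containing `F`. -/
theorem delta_amalgamRel_union (hE : IsLinearSpace (RestrictLS S E))
    (hF : IsLinearSpace (RestrictLS S F)) (hEF : E ∩ F = D) (hDE : Strong S D E)
    {A : Finset M} (hDA : D ⊆ A) (hAE : A ⊆ E) :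
    delta (amalgamRel S D E F) (A ∪ F) = delta S A + delta S F - delta S D := by
  have hG := isLinearSpace_amalgamRel hE hF hEF hDE
  have hDF : D ⊆ F := hEF ▸ Finset.inter_subset_right
  have hAF : A ∩ F = D :=
    ((Finset.inter_subset_inter_right hAE).trans hEF.subset).antisymm
      (Finset.subset_inter hDA hDF)
  have onE : ∀ {X : Finset M}, X ⊆ E → delta (amalgamRel S D E F) X = delta S X := fun hX =>
    delta_congr fun _ ha _ hb _ hc =>
      amalgamRel_iff_of_mem hE hF hEF (Or.inl rfl) (hX ha) (hX hb) (hX hc)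
  have onF : delta (amalgamRel S D E F) F = delta S F :=
    delta_congr fun _ ha _ hb _ hc =>
      amalgamRel_iff_of_mem hE hF hEF (Or.inr rfl) ha hb hc
  have hmod := delta_modular hG (A := A) (B := F) ?_
  · rw [hAF, onE hAE, onF, onE hDE.1] at hmod
    linarith
  · intro ℓ hℓ x hx y hy hxF hyA
    rw [mem_linesOf] at hℓ
    have hyF : y ∈ F := (Finset.mem_union.1 (hℓ.1 hy)).resolve_left hyA
    have hxA : x ∈ A := (Finset.mem_union.1 (hℓ.1 hx)).resolve_right hxF
    have hyE : y ∉ E := fun h => hyA (hDA (hEF ▸ Finset.mem_inter.2 ⟨h, hyF⟩))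
    have hxy : x ≠ y := fun h => hxF (h ▸ hyF)
    obtain ⟨z, hz, hzx, hzy⟩ : ∃ z ∈ ℓ, z ≠ x ∧ z ≠ y := by
      obtain ⟨z, hz, hz'⟩ := Finset.exists_mem_notMem_of_card_lt_card
        (lt_of_le_of_lt (Finset.card_le_two (a := x) (b := y)) hℓ.2.1)
      simp only [Finset.mem_insert, Finset.mem_singleton, not_or] at hz'
      exact ⟨z, hz, hz'⟩
    rcases amalgamRel_iff.1 (hℓ.2.2.1 x hx y hy z hz hxy hzy.symm hzx.symm) with h | h | h
    · exact absurd h.2.1 hyE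
    · exact absurd h.1 hxF
    obtain ⟨hxm, hym, -, -, -, -, p, hp, q, hq, hpq, h1, h2, -⟩ := h
    have base : ∀ d ∈ D, OnLine S p q d → d ∈ ℓ := by
      intro d hd hdl
      rw [hℓ.eq_lineThrough hG hxy hx hy]
      refine mem_lineThrough.2 ⟨Finset.mem_union_left _ (hDA hd), Or.inr (Or.inr ?_)⟩
      exact amalgamRel_iff.2 (Or.inr (Or.inr ⟨hxm, hym, Finset.mem_union_right _ (hDF hd), hxy,
        fun h => hyE (h ▸ hDE.1 hd), fun h => hxF (h ▸ hDF hd), p, hp, q, hq, hpq, h1, h2, hdl⟩))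
    rw [hAF]
    exact Finset.one_lt_card.2 ⟨p, Finset.mem_inter.2 ⟨base p hp (Or.inl rfl), hp⟩,
      q, Finset.mem_inter.2 ⟨base q hq (Or.inr (Or.inl rfl)), hq⟩, hpq⟩

theorem strong_amalgamRel (hE : IsLinearSpace (RestrictLS S E))
    (hF : IsLinearSpace (RestrictLS S F)) (hEF : E ∩ F = D) (hDE : Strong S D E) :
    Strong (amalgamRel S D E F) F (E ∪ F) := by
  refine ⟨Finset.subset_union_right, fun X hFX hX => ?_⟩
  have hDF : D ⊆ F := hEF ▸ Finset.inter_subset_right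
  have hXF : (X ∩ E) ∪ F = X := by
    ext x
    have h1 := @hX x
    have h2 := @hFX x
    simp only [Finset.mem_union, Finset.mem_inter] at h1 ⊢
    tauto
  have hDX : D ⊆ X ∩ E := Finset.subset_inter (hDF.trans hFX) hDE.1
  have e1 := delta_amalgamRel_union hE hF hEF hDE hDX Finset.inter_subset_right
  have e2 := delta_amalgamRel_union hE hF hEF hDE (Finset.Subset.refl D) hDE.1
  rw [hXF] at e1
  rw [Finset.union_eq_right.2 hDF] at e2
  have := hDE.2 _ hDX Finset.inter_subset_right
  linarith

end Amalgam

/-- Properties of the free amalgam `G = F ⊕_D E` of `F` and `E` over `D = E ∩ F`, where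
`D, E, F ∈ K₀` and `D ≤ E`: (1) `G` is a linear space (so any two distinct points of `G`
lie on at most one nontrivial line) and `G ∈ K₀`; (2) `δ(G) = δ(E) + δ(F) - δ(D)`; and
(3) `F ≤ G`. -/
theorem free_amalgam_in_K0 {M : Type*} (S : M → M → M → Prop) (D E F : Finset M)
    (hE : IsLinearSpace (RestrictLS S E)) (hF : IsLinearSpace (RestrictLS S F))
    (hEF : E ∩ F = D)
    (hKE : InK0 S E) (hKF : InK0 S F) (hKD : InK0 S D)
    (hDE : Strong S D E) :
    IsLinearSpace (amalgamRel S D E F) ∧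
    (∀ p q : M, p ∈ E ∪ F → q ∈ E ∪ F → p ≠ q →
      ∀ ℓ₁ ∈ linesOf (amalgamRel S D E F) (E ∪ F),
        ∀ ℓ₂ ∈ linesOf (amalgamRel S D E F) (E ∪ F),
          p ∈ ℓ₁ → q ∈ ℓ₁ → p ∈ ℓ₂ → q ∈ ℓ₂ → ℓ₁ = ℓ₂) ∧
    InK0 (amalgamRel S D E F) (E ∪ F) ∧
    delta (amalgamRel S D E F) (E ∪ F) = delta S E + delta S F - delta S D ∧
    Strong (amalgamRel S D E F) F (E ∪ F) := by
  have hG := isLinearSpace_amalgamRel hE hF hEF hDE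
  have hstrong := strong_amalgamRel hE hF hEF hDE
  refine ⟨hG, ?_, ?_, delta_amalgamRel_union hE hF hEF hDE hDE.1 (Finset.Subset.refl E),
    hstrong⟩
  · intro p q _ _ hpq ℓ₁ h₁ ℓ₂ h₂ hp₁ hq₁ hp₂ hq₂
    rw [(mem_linesOf.1 h₁).eq_lineThrough hG hpq hp₁ hq₁,
      (mem_linesOf.1 h₂).eq_lineThrough hG hpq hp₂ hq₂]
  · intro X hX
    have h1 := delta_submodular hG X F
    have h2 := hstrong.2 (X ∪ F) Finset.subset_union_right
      (Finset.union_subset hX Finset.subset_union_right)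
    have h3 : delta (amalgamRel S D E F) (X ∩ F) = delta S (X ∩ F) :=
      delta_congr fun _ ha _ hb _ hc =>
        amalgamRel_iff_of_mem hE hF hEF (Or.inr rfl) (Finset.mem_inter.1 ha).2
          (Finset.mem_inter.1 hb).2 (Finset.mem_inter.1 hc).2
    have h4 := hKF (X ∩ F) Finset.inter_subset_right
    linarith
end
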